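/- arXiv:1303.0904 — 3 statements merged into one kernel-verified Lean document; each statement's English description precedes it below -/
import Mathlib

section
/- Wren's theorem: for every real r > 0, the arc length of one arch of the cycloid generated by a circle of radius r, namely ∫₀^{2π} ‖γ'(t)‖ dt for γ(t) = (r(t − sin t), r(1 − cos t)), equals 8r. -/
open Real MeasureTheory

lemma hasDerivAt_cycloid (r t : ℝ) :
    HasDerivAt (fun t : ℝ => (WithLp.equiv 2 (Fin 2 → ℝ)).symm
      ![r * (t - Real.sin t), r * (1 - Real.cos t)])
      ((WithLp.equiv 2 (Fin 2 → ℝ)).symm ![r * (1 - Real.cos t), r * Real.sin t]) t := by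
  have h : HasDerivAt (fun t : ℝ => ![r * (t - Real.sin t), r * (1 - Real.cos t)])
      ![r * (1 - Real.cos t), r * Real.sin t] t := by
    rw [hasDerivAt_pi]
    intro i
    fin_cases i
    · exact ((hasDerivAt_id t).sub (Real.hasDerivAt_sin t)).const_mul r
    · simpa using ((Real.hasDerivAt_cos t).const_sub 1).const_mul r
  exact (PiLp.continuousLinearEquiv 2 ℝ (fun _ : Fin 2 => ℝ)).symm.hasFDerivAt.comp_hasDerivAt t h

lemma norm_cycloid_velocity {r t : ℝ} (hr : 0 ≤ r) (ht : t ∈ Set.Icc 0 (2 * π)) :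
    ‖(WithLp.equiv 2 (Fin 2 → ℝ)).symm ![r * (1 - Real.cos t), r * Real.sin t]‖ =
      2 * r * Real.sin (t / 2) := by
  have hs : 0 ≤ Real.sin (t / 2) :=
    Real.sin_nonneg_of_nonneg_of_le_pi (by linarith [ht.1]) (by linarith [ht.2])
  have hc : Real.cos t = 1 - 2 * Real.sin (t / 2) ^ 2 := by
    rw [Real.sin_sq_eq_half_sub, mul_div_cancel₀ t two_ne_zero]
    ring
  rw [← sq_eq_sq₀ (norm_nonneg _) (by positivity), EuclideanSpace.norm_sq_eq]
  simp only [Fin.sum_univ_two, WithLp.equiv_symm_apply, Matrix.cons_val_zero,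
    Matrix.cons_val_one, Real.norm_eq_abs, sq_abs, mul_pow, Real.sin_sq t, hc]
  ring

/-- Wren's theorem: for `r > 0`, the arc length of one arch of the cycloid
`γ t = (r(t − sin t), r(1 − cos t))`, i.e. `∫ t in [0, 2π], ‖γ' t‖`, equals `8r`. -/
theorem cycloid_arch_arclength (r : ℝ) (hr : 0 < r)
    (γ : ℝ → EuclideanSpace ℝ (Fin 2))
    (hγ : γ = fun t => (WithLp.equiv 2 (Fin 2 → ℝ)).symm
      ![r * (t - Real.sin t), r * (1 - Real.cos t)]) :
    (∫ t in (0:ℝ)..(2 * π), ‖deriv γ t‖) = 8 * r := by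
  have h : Set.EqOn (fun t => ‖deriv γ t‖) (fun t => 2 * r * Real.sin (t / 2))
      (Set.uIcc 0 (2 * π)) := by
    intro t ht
    rw [Set.uIcc_of_le Real.two_pi_pos.le] at ht
    simp only [hγ]
    rw [(hasDerivAt_cycloid r t).deriv, norm_cycloid_velocity hr.le ht]
  rw [intervalIntegral.integral_congr h, intervalIntegral.integral_const_mul,
    intervalIntegral.integral_comp_div (fun x => Real.sin x) two_ne_zero, integral_sin,
    mul_div_cancel_left₀ _ two_ne_zero, zero_div, Real.cos_zero, Real.cos_pi, smul_eq_mul]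
  ring
end

section
/- Tangent property of the Archimedean spiral (On Spirals, Proposition 18): for every real a > 0, let γ(θ) = a·θ·(cos θ, sin θ) be the arithmetic spiral and A = γ(2π) = (2πa, 0) the end of the first turn. The tangent line to the spiral at A meets the line through the origin perpendicular to OA (the y-axis) at a point B whose distance from the origin equals 4π²a, the circumference of the circle of radius 2πa. -/
open Real

/-- The velocity of the Archimedean spiral `θ ↦ a·θ·(cos θ, sin θ)`. -/
theorem hasDerivAt_archimedean_spiral (a θ : ℝ) :
    HasDerivAt (fun θ : ℝ => (WithLp.equiv 2 (Fin 2 → ℝ)).symm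
        ![a * θ * Real.cos θ, a * θ * Real.sin θ])
      (!₂[a * Real.cos θ - a * θ * Real.sin θ, a * Real.sin θ + a * θ * Real.cos θ] :
        EuclideanSpace ℝ (Fin 2)) θ := by
  have hlin : HasDerivAt (fun θ : ℝ => a * θ) a θ := by
    simpa using (hasDerivAt_id θ).const_mul a
  have hcoord : HasDerivAt (fun θ : ℝ => ![a * θ * Real.cos θ, a * θ * Real.sin θ])
      ![a * Real.cos θ - a * θ * Real.sin θ, a * Real.sin θ + a * θ * Real.cos θ] θ := by
    rw [hasDerivAt_pi]
    intro i
    fin_cases i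
    · exact (hlin.fun_mul (Real.hasDerivAt_cos θ)).congr_deriv
        (by rw [mul_neg, ← sub_eq_add_neg]; rfl)
    · exact hlin.fun_mul (Real.hasDerivAt_sin θ)
  exact (EuclideanSpace.equiv (Fin 2) ℝ).symm.hasFDerivAt.comp_hasDerivAt θ hcoord

/-- Tangent property of the Archimedean spiral (*On Spirals*, Proposition 18):
for `a > 0`, let `γ θ = a·θ·(cos θ, sin θ)` and let `A = γ (2π)` be the end of
the first turn. The tangent line to the spiral at `A` meets the `y`-axis (the
line through the origin perpendicular to `OA`) at a point `B` whose distance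
from the origin equals `4π²a`, the circumference of the circle of radius `2πa`. -/
theorem archimedean_spiral_tangent (a : ℝ) (ha : 0 < a)
    (γ : ℝ → EuclideanSpace ℝ (Fin 2))
    (hγ : γ = fun θ => (WithLp.equiv 2 (Fin 2 → ℝ)).symm
      ![a * θ * Real.cos θ, a * θ * Real.sin θ]) :
    ∃ B : EuclideanSpace ℝ (Fin 2),
      (∃ s : ℝ, B = γ (2 * π) + s • deriv γ (2 * π)) ∧
      B 0 = 0 ∧
      dist B (0 : EuclideanSpace ℝ (Fin 2)) = 4 * π ^ 2 * a := by
  subst hγ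
  refine ⟨_, ⟨-(2 * π), rfl⟩, ?_, ?_⟩
  · rw [(hasDerivAt_archimedean_spiral a (2 * π)).deriv]
    simp
    ring
  · rw [(hasDerivAt_archimedean_spiral a (2 * π)).deriv, dist_zero_right,
      EuclideanSpace.norm_eq, Real.sqrt_eq_iff_mul_self_eq (by positivity) (by positivity)]
    simp [Fin.sum_univ_two]
    ring
end

section
/- Euclid I.21: if E, F, G are the vertices of a triangle in the Euclidean plane and H is a point in the interior of the triangle, then the sum of the distances from H to E and from H to F is strictly less than the sum of the distances from G to E and from G to F: dist(E, H) + dist(H, F) < dist(E, G) + dist(G, F). -/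
/-- A point in the interior of a set is a proper convex combination of any given point and some point
of the set. -/
theorem exists_smul_add_smul_eq_of_mem_interior {V : Type*} [NormedAddCommGroup V]
    [NormedSpace ℝ V] {s : Set V} {x : V} (hx : x ∈ interior s) (y : V) :
    ∃ z ∈ s, ∃ a b : ℝ, 0 < a ∧ 0 < b ∧ a + b = 1 ∧ a • y + b • z = x := by
  have hc : Filter.Tendsto (fun t : ℝ => x + t • (x - y)) (nhdsWithin 0 (Set.Ioi 0)) (nhds x) := by
    have h : Continuous (fun t : ℝ => x + t • (x - y)) := by fun_prop
    simpa using (h.tendsto 0).mono_left nhdsWithin_le_nhds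
  obtain ⟨t, hts, ht⟩ :=
    ((hc.eventually (mem_interior_iff_mem_nhds.mp hx)).and self_mem_nhdsWithin).exists
  have ht : 0 < t := ht
  refine ⟨_, hts, t / (1 + t), 1 / (1 + t), by positivity, by positivity, by field_simp; ring, ?_⟩
  match_scalars
  · field_simp
    ring
  · field_simp

/-- Euclid I.21: if `E, F, G` are the vertices of a triangle in the Euclidean
plane (not collinear) and `H` lies in the interior of the triangle (the
topological interior of the convex hull of `{E, F, G}`), then
`dist E H + dist H F < dist E G + dist G F`. -/
theorem euclid_I_21 (E F G H : EuclideanSpace ℝ (Fin 2))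
    (hEFG : ¬ Collinear ℝ ({E, F, G} : Set (EuclideanSpace ℝ (Fin 2))))
    (hH : H ∈ interior (convexHull ℝ ({E, F, G} : Set (EuclideanSpace ℝ (Fin 2))))) :
    dist E H + dist H F < dist E G + dist G F := by
  have hconv : ConvexOn ℝ Set.univ (fun x => dist E x + dist x F) := by
    simp only [dist_comm E]
    exact (convexOn_univ_dist E).add (convexOn_univ_dist F)
  have hlt : dist E F < dist E G + dist G F := by
    refine dist_lt_dist_add_dist_iff.mpr fun h => hEFG ?_
    simpa only [Set.pair_comm] using h.collinear
  obtain ⟨K, hK, a, b, ha, hb, hab, rfl⟩ := exists_smul_add_smul_eq_of_mem_interior hH E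
  have hKle : dist E K + dist K F ≤ dist E G + dist G F := by
    obtain ⟨v, hv, hle⟩ := hconv.exists_ge_of_mem_convexHull (Set.subset_univ _) hK
    rcases hv with rfl | rfl | rfl
    · simpa using hle.trans (by simpa using hlt.le)
    · simpa using hle.trans (by simpa using hlt.le)
    · exact hle
  have hle := hconv.2 (Set.mem_univ E) (Set.mem_univ K) ha.le hb.le hab
  simp only [dist_self, zero_add, smul_eq_mul] at hle
  calc _ ≤ _ := hle
    _ < a * (dist E G + dist G F) + b * (dist E G + dist G F) :=
      add_lt_add_of_lt_of_le (mul_lt_mul_of_pos_left hlt ha) (mul_le_mul_of_nonneg_left hKle hb.le)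
    _ = dist E G + dist G F := by rw [← add_mul, hab, one_mul]
end
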